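/- For every s ≥ 1 the following two inequalities hold: (i) [0; b^s, 1, 2, \overline{1,3}] + [0; c^s, \overline{1,3}] > 2·[0; b^s, 4, \overline{1,3}]; and (ii) 2·[0; b^s, \overline{1,3}] > [0; b^{s+1}, 4, \overline{1,3}] + [0; c^{s+1}, 4, \overline{1,3}]. -/

import Mathlib

open Filter Set
open scoped Pointwise

noncomputable section

/-- The `n`-th convergent of the continued fraction `[0; a 0, a 1, a 2, …]`. -/
def cfConv : ℕ → (ℕ → ℕ) → ℝ
  | 0, _ => 0
  | n + 1, a => 1 / (a 0 + cfConv n fun i => a (i + 1))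

/-- The value `[0; a 0, a 1, a 2, …]` of the infinite continued fraction with
partial quotients `a 0, a 1, …` (the limit of its convergents). -/
def cfVal (a : ℕ → ℕ) : ℝ := limUnder atTop fun n => cfConv n a

/-- The sequence of partial quotients obtained by concatenating the finite word `b`
with the sequence `θ`. -/
def app (b : List ℕ) (θ : ℕ → ℕ) : ℕ → ℕ := fun n =>
  if h : n < b.length then b.get ⟨n, h⟩ else θ (n - b.length)

/-- The forbidden pairs of consecutive partial quotients. -/
def badPairs : Set (ℕ × ℕ) := {(1, 4), (2, 4)}

/-- The set `D` of sequences with entries in `{1,2,3,4}` avoiding the pairs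
`(1,4)` and `(2,4)`. -/
def Dset : Set (ℕ → ℕ) :=
  {θ | (∀ n, θ n ∈ ({1, 2, 3, 4} : Set ℕ)) ∧ ∀ n, (θ n, θ (n + 1)) ∉ badPairs}

/-- The Cantor set `K(b) = {[0; b, θ] : θ ∈ D, (b_s, θ_1) ∉ {(1,4),(2,4)}}`. -/
def Kb (b : List ℕ) : Set ℝ :=
  {x | ∃ θ ∈ Dset, (∀ d, b.getLast? = some d → (d, θ 0) ∉ badPairs) ∧
    x = cfVal (app b θ)}

/-- The set `K̃(b) ⊆ K(b)` of values `[0; b, θ]` with moreover `(θ_1, θ_2) ≠ (1,3)`. -/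
def Ktil (b : List ℕ) : Set ℝ :=
  {x | ∃ θ ∈ Dset, (∀ d, b.getLast? = some d → (d, θ 0) ∉ badPairs) ∧
    (θ 0, θ 1) ≠ (1, 3) ∧ x = cfVal (app b θ)}

/-- The word `b^s = (1,4)_s`. -/
def bW (s : ℕ) : List ℕ := (List.replicate s [1, 4]).flatten

/-- The word `c^s = (1,4)_{s-1}, 1, 3`. -/
def cW (s : ℕ) : List ℕ := bW (s - 1) ++ [1, 3]

/-- The periodic sequence `\overline{1,3}`. -/
def per13 : ℕ → ℕ := fun n => if n % 2 = 0 then 1 else 3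

/-- The periodic sequence `\overline{3,1}`. -/
def per31 : ℕ → ℕ := fun n => if n % 2 = 0 then 3 else 1

open scoped Topology

theorem cfConv_nonneg (n : ℕ) (a : ℕ → ℕ) : 0 ≤ cfConv n a := by
  induction n generalizing a with
  | zero => exact le_refl _
  | succ n ih =>
    have := ih fun i => a (i + 1)
    simp only [cfConv]
    positivity

theorem app_nil (θ : ℕ → ℕ) : app [] θ = θ := by
  funext n
  simp [app]

theorem app_cons_zero (c : ℕ) (w : List ℕ) (θ : ℕ → ℕ) : app (c :: w) θ 0 = c := by
  simp [app]

theorem app_cons_succ (c : ℕ) (w : List ℕ) (θ : ℕ → ℕ) :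
    (fun i => app (c :: w) θ (i + 1)) = app w θ := by
  funext n
  simp [app]

/-- The convergents of `[0; a 0, a 1, …]` tend to the nonnegative number `x`. -/
def CfTendsto (a : ℕ → ℕ) (x : ℝ) : Prop :=
  0 ≤ x ∧ Tendsto (fun n => cfConv n a) atTop (𝓝 x)

theorem CfTendsto.cfVal_eq {a : ℕ → ℕ} {x : ℝ} (h : CfTendsto a x) : cfVal a = x :=
  h.2.limUnder_eq

theorem CfTendsto.cons {w : List ℕ} {θ : ℕ → ℕ} {x : ℝ} (h : CfTendsto (app w θ) x)
    {c : ℕ} (hc : 0 < c) : CfTendsto (app (c :: w) θ) (1 / (c + x)) := by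
  obtain ⟨hx, ht⟩ := h
  have hc' : (0 : ℝ) < c := by exact_mod_cast hc
  refine ⟨by positivity, ?_⟩
  rw [← tendsto_add_atTop_iff_nat 1]
  simp only [cfConv, app_cons_zero, app_cons_succ]
  exact tendsto_const_nhds.div (tendsto_const_nhds.add ht) (by positivity)

theorem bW_succ (n : ℕ) : bW (n + 1) = 1 :: 4 :: bW n := by
  simp [bW, List.replicate_succ]

theorem bW_succ' (n : ℕ) : bW (n + 1) = bW n ++ [1, 4] := by
  simp [bW, List.replicate_succ']

/-- Prepending the word `(1,4)` repeated `n` times acts by a unimodular Möbius map with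
nonnegative coefficients. -/
theorem exists_mobius_bW (n : ℕ) : ∃ p q r t : ℝ, 0 ≤ p ∧ 0 ≤ q ∧ 0 ≤ r ∧ 0 < t ∧
    p * t - q * r = 1 ∧ ∀ (w : List ℕ) (θ : ℕ → ℕ) (x : ℝ), CfTendsto (app w θ) x →
      CfTendsto (app (bW n ++ w) θ) ((p * x + q) / (r * x + t)) := by
  induction n with
  | zero =>
    refine ⟨1, 0, 0, 1, by norm_num, by norm_num, by norm_num, by norm_num, by norm_num, ?_⟩
    intro w θ x h
    simpa [bW] using h
  | succ n ih =>
    obtain ⟨p, q, r, t, hp, hq, hr, ht, hdet, H⟩ := ih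
    refine ⟨p + 4 * r, q + 4 * t, p + 5 * r, q + 5 * t, by positivity, by positivity,
      by positivity, by positivity, by linear_combination hdet, ?_⟩
    intro w θ x h
    have h2 := ((H w θ x h).cons (c := 4) (by norm_num)).cons (c := 1) (by norm_num)
    rw [bW_succ]
    have hx := h.1
    have hd : 0 < r * x + t := by positivity
    have hn : 0 ≤ p * x + q := by positivity
    have e : ((p + 4 * r) * x + (q + 4 * t)) / ((p + 5 * r) * x + (q + 5 * t)) =
        1 / (1 + 1 / (4 + (p * x + q) / (r * x + t))) := by
      have : 1 + 1 / (4 + (p * x + q) / (r * x + t)) ≠ 0 := by positivity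
      have : (r * x + t) * 4 + (p * x + q) ≠ 0 := by positivity
      field_simp
      ring
    simpa [e] using h2

theorem exists_per13 : ∃ v : ℝ, v ^ 2 + 3 * v - 3 = 0 ∧ 0 < v ∧ CfTendsto per13 v := by
  have hs : (√21 : ℝ) ^ 2 = 21 := Real.sq_sqrt (by norm_num)
  have hs4 : (4 : ℝ) < √21 := Real.lt_sqrt (by norm_num) |>.2 (by norm_num)
  have hs5 : (√21 : ℝ) < 5 := Real.sqrt_lt' (by norm_num) |>.2 (by norm_num)
  obtain ⟨v, hv⟩ : ∃ v : ℝ, v = (√21 - 3) / 2 := ⟨_, rfl⟩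
  have hv0 : 0 < v := by linarith
  have hv1 : v < 1 := by linarith
  have hq : v ^ 2 + 3 * v - 3 = 0 := by rw [hv]; linear_combination hs / 4
  have step (n : ℕ) : cfConv (n + 2) per13 = 1 / (1 + 1 / (3 + cfConv n per13)) := by
    have h : (fun i => per13 (i + 1 + 1)) = per13 := by
      funext i
      simp [per13, add_assoc]
    simp only [cfConv, h]
    norm_num [per13]
  have key (n : ℕ) : |cfConv n per13 - v| ≤ (1 / 2) ^ n := by
    induction n using Nat.twoStepInduction with
    | zero =>
      simp only [cfConv]
      rw [abs_le]
      constructor <;> norm_num <;> linarith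
    | one =>
      simp only [cfConv, per13]
      rw [abs_le]
      constructor <;> norm_num <;> linarith
    | more n ih _ =>
      rw [step]
      have hc := cfConv_nonneg n per13
      set c := cfConv n per13
      have e : 1 / (1 + 1 / (3 + c)) - v = (c - v) * (1 / ((4 + c) * (4 + v))) := by
        have : 1 + 1 / (3 + c) ≠ 0 := by positivity
        have : 3 + c + 1 ≠ 0 := by positivity
        field_simp
        linear_combination -(4 + c) ^ 2 * hq
      have hle : 1 / ((4 + c) * (4 + v)) ≤ (1 / 2) ^ 2 := by
        rw [div_le_iff₀ (by positivity)]
        nlinarith [mul_nonneg hc hv0.le]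
      rw [e, abs_mul, abs_of_nonneg (a := 1 / ((4 + c) * (4 + v))) (by positivity), pow_add]
      gcongr
  refine ⟨v, hq, hv0, hv0.le, ?_⟩
  rw [tendsto_iff_dist_tendsto_zero]
  exact squeeze_zero (fun _ => dist_nonneg) (fun n => by rw [Real.dist_eq]; exact key n)
    (tendsto_pow_atTop_nhds_zero_of_lt_one (by norm_num) (by norm_num))

theorem mobius_sub {p q r t x y : ℝ} (hdet : p * t - q * r = 1)
    (hx : r * x + t ≠ 0) (hy : r * y + t ≠ 0) :
    (p * x + q) / (r * x + t) - (p * y + q) / (r * y + t) =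
      (x - y) / ((r * x + t) * (r * y + t)) := by
  rw [div_sub_div _ _ hx hy]
  congr 1
  linear_combination (x - y) * hdet

theorem two_mul_mobius_lt {p q r t x y z : ℝ} (hdet : p * t - q * r = 1)
    (hx : 0 < r * x + t) (hy : 0 < r * y + t) (hz : 0 < r * z + t)
    (h : (y - z) * (r * x + t) < (x - y) * (r * z + t)) :
    2 * ((p * y + q) / (r * y + t)) <
      (p * x + q) / (r * x + t) + (p * z + q) / (r * z + t) := by
  have h1 := mobius_sub hdet hx.ne' hy.ne'
  have h2 := mobius_sub hdet hy.ne' hz.ne'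
  have h3 : (y - z) / ((r * y + t) * (r * z + t)) < (x - y) / ((r * x + t) * (r * y + t)) := by
    rw [div_lt_div_iff₀ (by positivity) (by positivity)]
    nlinarith [mul_lt_mul_of_pos_left h hy]
  linarith

theorem lt_two_mul_mobius {p q r t x y z : ℝ} (hdet : p * t - q * r = 1)
    (hx : 0 < r * x + t) (hy : 0 < r * y + t) (hz : 0 < r * z + t)
    (h : (x - y) * (r * z + t) < (y - z) * (r * x + t)) :
    (p * x + q) / (r * x + t) + (p * z + q) / (r * z + t) <
      2 * ((p * y + q) / (r * y + t)) := by
  have h1 := mobius_sub hdet hx.ne' hy.ne'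
  have h2 := mobius_sub hdet hy.ne' hz.ne'
  have h3 : (x - y) / ((r * x + t) * (r * y + t)) < (y - z) / ((r * y + t) * (r * z + t)) := by
    rw [div_lt_div_iff₀ (by positivity) (by positivity)]
    nlinarith [mul_lt_mul_of_pos_left h hy]
  linarith

/-- For every `s ≥ 1`:
(i) `[0; b^s,1,2,\overline{1,3}] + [0; c^s,\overline{1,3}] > 2·[0; b^s,4,\overline{1,3}]`;
(ii) `2·[0; b^s,\overline{1,3}] > [0; b^{s+1},4,\overline{1,3}] + [0; c^{s+1},4,\overline{1,3}]`. -/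
theorem gluing_inequalities (s : ℕ) (hs : 1 ≤ s) :
    cfVal (app (bW s ++ [1, 2]) per13) + cfVal (app (cW s) per13) >
        2 * cfVal (app (bW s ++ [4]) per13) ∧
    2 * cfVal (app (bW s) per13) >
        cfVal (app (bW (s + 1) ++ [4]) per13) + cfVal (app (cW (s + 1) ++ [4]) per13) := by
  obtain ⟨v, hq, hv0, hv⟩ := exists_per13
  have hvl : 0.7912 < v := by nlinarith
  have hvu : v < 0.7913 := by nlinarith
  have hnil : CfTendsto (app [] per13) v := by rwa [app_nil]
  have h4 := hnil.cons (c := 4) (by norm_num)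
  constructor
  · obtain ⟨n, rfl⟩ : ∃ n, s = n + 1 := ⟨s - 1, by omega⟩
    obtain ⟨p, q, r, t, hp, hq', hr, ht, hdet, H⟩ := exists_mobius_bW n
    have h12 := ((hnil.cons (c := 2) (by norm_num)).cons (c := 1) (by norm_num)).cons
      (c := 4) (by norm_num) |>.cons (c := 1) (by norm_num)
    have h13 := (hnil.cons (c := 3) (by norm_num)).cons (c := 1) (by norm_num)
    have h144 := (h4.cons (c := 4) (by norm_num)).cons (c := 1) (by norm_num)
    have e1 := H _ _ _ h12
    have e2 := H _ _ _ h13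
    have e3 := H _ _ _ h144
    have w1 : bW (n + 1) ++ [1, 2] = bW n ++ [1, 4, 1, 2] := by simp [bW_succ']
    have w2 : cW (n + 1) = bW n ++ [1, 3] := by simp [cW]
    have w3 : bW (n + 1) ++ [4] = bW n ++ [1, 4, 4] := by simp [bW_succ']
    rw [w1, w2, w3, e1.cfVal_eq, e2.cfVal_eq, e3.cfVal_eq]
    have hx := h12.1
    have hy := h144.1
    have hz := h13.1
    refine two_mul_mobius_lt hdet (by positivity) (by positivity) (by positivity) ?_
    have bx :
        0.82565 < (1 / ((1 : ℕ) + 1 / ((4 : ℕ) + 1 / ((1 : ℕ) + 1 / ((2 : ℕ) + v)))) : ℝ) ∧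
        (1 / ((1 : ℕ) + 1 / ((4 : ℕ) + 1 / ((1 : ℕ) + 1 / ((2 : ℕ) + v)))) : ℝ) < 0.82568 := by
      push_cast
      constructor
      · field_simp
        nlinarith
      · field_simp
        nlinarith
    have bz :
        0.7912 < (1 / ((1 : ℕ) + 1 / ((3 : ℕ) + v)) : ℝ) ∧
        (1 / ((1 : ℕ) + 1 / ((3 : ℕ) + v)) : ℝ) < 0.7913 := by
      push_cast
      constructor
      · field_simp
        nlinarith
      · field_simp
        nlinarith
    have bd :
        0.80800 < (1 / ((1 : ℕ) + 1 / ((4 : ℕ) + 1 / ((4 : ℕ) + v))) : ℝ) ∧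
        (1 / ((1 : ℕ) + 1 / ((4 : ℕ) + 1 / ((4 : ℕ) + v))) : ℝ) < 0.80802 := by
      push_cast
      constructor
      · field_simp
        nlinarith
      · field_simp
        nlinarith
    generalize (1 / ((1 : ℕ) + 1 / ((4 : ℕ) + 1 / ((1 : ℕ) + 1 / ((2 : ℕ) + v)))) : ℝ) = x at *
    generalize (1 / ((1 : ℕ) + 1 / ((4 : ℕ) + 1 / ((4 : ℕ) + v))) : ℝ) = y at *
    generalize (1 / ((1 : ℕ) + 1 / ((3 : ℕ) + v)) : ℝ) = z at *
    have k1 : (y - z) * x < (x - y) * z := by nlinarith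
    have k2 : y - z < x - y := by linarith
    nlinarith [mul_le_mul_of_nonneg_left k1.le hr, mul_lt_mul_of_pos_left k2 ht]
  · obtain ⟨p, q, r, t, hp, hq', hr, ht, hdet, H⟩ := exists_mobius_bW s
    have h144 := (h4.cons (c := 4) (by norm_num)).cons (c := 1) (by norm_num)
    have h134 := (h4.cons (c := 3) (by norm_num)).cons (c := 1) (by norm_num)
    have e1 := H _ _ _ hnil
    have e2 := H _ _ _ h144
    have e3 := H _ _ _ h134
    have w1 : bW (s + 1) ++ [4] = bW s ++ [1, 4, 4] := by simp [bW_succ']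
    have w2 : cW (s + 1) ++ [4] = bW s ++ [1, 3, 4] := by simp [cW]
    rw [List.append_nil] at e1
    rw [w1, w2, e1.cfVal_eq, e2.cfVal_eq, e3.cfVal_eq]
    have hy := hv.1
    have hx := h144.1
    have hz := h134.1
    refine lt_two_mul_mobius hdet (by positivity) (by positivity) (by positivity) ?_
    have bx :
        0.80800 < (1 / ((1 : ℕ) + 1 / ((4 : ℕ) + 1 / ((4 : ℕ) + v))) : ℝ) ∧
        (1 / ((1 : ℕ) + 1 / ((4 : ℕ) + 1 / ((4 : ℕ) + v))) : ℝ) < 0.80802 := by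
      push_cast
      constructor
      · field_simp
        nlinarith
      · field_simp
        nlinarith
    have bz :
        0.76238 < (1 / ((1 : ℕ) + 1 / ((3 : ℕ) + 1 / ((4 : ℕ) + v))) : ℝ) ∧
        (1 / ((1 : ℕ) + 1 / ((3 : ℕ) + 1 / ((4 : ℕ) + v))) : ℝ) < 0.76242 := by
      push_cast
      constructor
      · field_simp
        nlinarith
      · field_simp
        nlinarith
    generalize (1 / ((1 : ℕ) + 1 / ((4 : ℕ) + 1 / ((4 : ℕ) + v))) : ℝ) = x at *
    generalize (1 / ((1 : ℕ) + 1 / ((3 : ℕ) + 1 / ((4 : ℕ) + v))) : ℝ) = z at *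
    have k1 : (x - v) * z < (v - z) * x := by nlinarith
    have k2 : x - v < v - z := by linarith
    nlinarith [mul_le_mul_of_nonneg_left k1.le hr, mul_lt_mul_of_pos_left k2 ht]
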